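/- Let V be a type, let E : V → V → Prop be the edge relation of a computational graph such that E is well-founded (each node's parents precede it), let α be a type of node values, and let f : V → (V → α) → α be the local node functions, assumed to depend only on parent values: for all v and g g' : V → α, if g u = g' u for every u with E u v, then f v g = f v g'. Let B S : Set V and let val₁ val₂ : V → α be two value assignments satisfying local consistency on B \ S: for every v ∈ B with v ∉ S, val₁ v = f v val₁ and val₂ v = f v val₂. Assume the separator condition: for every v ∈ B with v ∉ S and every u with E u v, either u ∈ B or u ∈ S. If val₁ and val₂ agree on S, then val₁ and val₂ agree on all of B. -/

import Mathlib

/-- A separator implies sufficiency: in a computational graph with well-founded edge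
relation `E` and local node functions `f` depending only on parent values, if every
parent of a non-separator node of `B` lies in `B ∪ S` (the separator condition),
then any two value assignments that are locally consistent on `B \ S` and agree on
the separator `S` agree on all of `B`. -/
theorem separator_implies_sufficiency
    {V α : Type*} (E : V → V → Prop) (hwf : WellFounded E)
    (f : V → (V → α) → α)
    (hlocal : ∀ (v : V) (g g' : V → α), (∀ u, E u v → g u = g' u) → f v g = f v g')
    (B S : Set V) (val₁ val₂ : V → α)
    (hcons₁ : ∀ v ∈ B, v ∉ S → val₁ v = f v val₁)
    (hcons₂ : ∀ v ∈ B, v ∉ S → val₂ v = f v val₂)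
    (hsep : ∀ v ∈ B, v ∉ S → ∀ u, E u v → u ∈ B ∨ u ∈ S)
    (hS : ∀ v ∈ S, val₁ v = val₂ v) :
    ∀ v ∈ B, val₁ v = val₂ v := by
  intro v
  induction v using hwf.induction with
  | _ v ih =>
    intro hvB
    by_cases hvS : v ∈ S
    · exact hS v hvS
    · rw [hcons₁ v hvB hvS, hcons₂ v hvB hvS]
      exact hlocal v val₁ val₂ fun u huv =>
        (hsep v hvB hvS u huv).elim (ih u huv) (hS u)
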